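/- arXiv:1601.05193 — 3 statements merged into one kernel-verified Lean document; each statement's English description precedes it below -/
import Mathlib

section
/- (Theorem 2) For any binary linear block code transmitted with BPSK over an AWGN channel with noise variance σ², every decoder ψ satisfies BER_ψ ≥ (1/k) ∑_{i=0}^{k-1} Q(√(d_{min,i}) / σ); in particular the bit-error probability under MAP decoding is lower-bounded by (1/k) ∑_{i=0}^{k-1} Q(√(d_{min,i}) / σ). -/
open MeasureTheory ProbabilityTheory

/-- The Gaussian tail function `Q(x) = ∫_x^∞ (1/√(2π)) e^{-t²/2} dt`. -/
noncomputable def Qfun (x : ℝ) : ℝ :=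
  ∫ t in Set.Ioi x, (1 / Real.sqrt (2 * Real.pi)) * Real.exp (-(t ^ 2) / 2)

/-- BPSK modulation: bit `b ↦ (-1)^b`. -/
noncomputable def bpsk (b : ZMod 2) : ℝ := if b = 0 then 1 else -1

open scoped NNReal ENNReal

lemma Qfun_eq_gaussianReal (x : ℝ) : Qfun x = (gaussianReal 0 1).real (Set.Ioi x) := by
  rw [Measure.real, gaussianReal_apply_eq_integral 0 one_ne_zero, ENNReal.toReal_ofReal
    (integral_nonneg fun _ => gaussianPDFReal_nonneg _ _ _), Qfun]
  simp [gaussianPDFReal]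

lemma gaussianReal_real_Ioi_zero (m : ℝ) {s : ℝ} (hs : 0 < s) :
    (gaussianReal (-m) (s ^ 2).toNNReal).real (Set.Ioi 0) = Qfun (m / s) := by
  have h : gaussianReal (-m) (s ^ 2).toNNReal = (gaussianReal 0 1).map fun x => s * x + -m := by
    have := gaussianReal_map_add_const (μ := s * 0) (v := .mk (s ^ 2) (sq_nonneg _) * 1) (-m)
    rw [← gaussianReal_map_const_mul, Measure.map_map (by fun_prop) (by fun_prop)] at this
    refine Eq.trans ?_ this.symm
    congr 1
    · simp
    · ext; simp [sq_nonneg]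
  rw [h, map_measureReal_apply (by fun_prop) measurableSet_Ioi, Qfun_eq_gaussianReal]
  congr 1
  ext x
  simp [div_lt_iff₀ hs, mul_comm]

lemma gaussianReal_real_Iic_zero (m : ℝ) {s : ℝ} (hs : 0 < s) :
    (gaussianReal m (s ^ 2).toNNReal).real (Set.Iic 0) = Qfun (m / s) := by
  have hv : (s ^ 2).toNNReal ≠ 0 := by simpa using hs.ne'
  have := nullSingletonClass_gaussianReal (μ := m) hv
  rw [measureReal_congr Iio_ae_eq_Iic.symm, ← gaussianReal_real_Ioi_zero m hs,
    ← gaussianReal_map_neg, map_measureReal_apply (by fun_prop) measurableSet_Ioi]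
  congr 1
  ext x
  simp

lemma pi_gaussianReal_map_sum {ι : Type*} [Fintype ι] (m : ι → ℝ) (v : ι → ℝ≥0) :
    (Measure.pi fun i => gaussianReal (m i) (v i)).map (fun x => ∑ i, x i) =
      gaussianReal (∑ i, m i) (∑ i, v i) := by
  have hmap (i : ι) := (measurePreserving_eval (fun i => gaussianReal (m i) (v i)) i).map_eq
  have hlaw : HasGaussianLaw (fun x : ι → ℝ => ∑ i, x i)
      (Measure.pi fun i => gaussianReal (m i) (v i)) :=
    iIndepFun.hasGaussianLaw_fun_sum (X := fun i (x : ι → ℝ) => x i)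
      (fun i => ⟨by
        rw [show (fun x : ι → ℝ => x i) = Function.eval i from rfl, hmap]; infer_instance⟩)
      (iIndepFun_pi (X := fun _ x => x) fun i => aemeasurable_id)
  rw [hlaw.map_eq_gaussianReal]
  congr 1
  · rw [integral_finsetSum]
    · exact Finset.sum_congr rfl fun i _ =>
        (integral_comp_eval (μ := fun i => gaussianReal (m i) (v i)) (f := fun x => x)
          (by fun_prop)).trans integral_id_gaussianReal
    · intro i _
      exact integrable_comp_eval (f := fun x => x)
        ((memLp_id_gaussianReal 1).integrable (by norm_num))
  · have := variance_sum_pi (μ := fun i => gaussianReal (m i) (v i)) (X := fun i x => x)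
      fun i => memLp_id_gaussianReal 2
    rw [show (fun x : ι → ℝ => ∑ i, x i) = ∑ i, fun x => x i by ext; simp, this]
    simp [← NNReal.coe_sum]

lemma gaussianReal_map_mul_sub (m w c : ℝ) (v : ℝ≥0) :
    (gaussianReal m v).map (fun x => w * (x - c)) =
      gaussianReal (w * (m - c)) ((w ^ 2).toNNReal * v) := by
  rw [← Function.comp_def (fun x => w * x) (fun x => x - c),
    ← Measure.map_map (by fun_prop) (by fun_prop), gaussianReal_map_sub_const,
    gaussianReal_map_const_mul]
  congr
  simp [sq_nonneg]

lemma pi_gaussianReal_map_sum_mul_sub {ι : Type*} [Fintype ι] (m w c : ι → ℝ) (v : ℝ≥0) :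
    (Measure.pi fun i => gaussianReal (m i) v).map (fun x => ∑ i, w i * (x i - c i)) =
      gaussianReal (∑ i, w i * (m i - c i)) ((∑ i, w i ^ 2).toNNReal * v) := by
  have := pi_gaussianReal_map_sum (fun i => w i * (m i - c i)) fun i => (w i ^ 2).toNNReal * v
  simp_rw [← gaussianReal_map_mul_sub] at this
  rw [← Measure.pi_map_pi (by fun_prop), Measure.map_map (by fun_prop) (by fun_prop),
    ← Finset.sum_mul, ← Real.toNNReal_sum_of_nonneg fun i _ => sq_nonneg _] at this
  exact this

lemma pi_withDensity {ι : Type*} [Fintype ι] {α : ι → Type*} [∀ i, MeasurableSpace (α i)]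
    (μ : ∀ i, Measure (α i)) [∀ i, IsProbabilityMeasure (μ i)] {f : ∀ i, α i → ℝ≥0∞}
    (hf : ∀ i, Measurable (f i)) [∀ i, SigmaFinite ((μ i).withDensity (f i))] :
    Measure.pi (fun i => (μ i).withDensity (f i)) =
      (Measure.pi μ).withDensity fun x => ∏ i, f i (x i) := by
  refine Measure.pi_eq fun s hs => ?_
  have hind (x : ∀ i, α i) : (Set.univ.pi s).indicator (fun x => ∏ i, f i (x i)) x =
      ∏ i, (s i).indicator (f i) (x i) := by
    classical
    by_cases hx : x ∈ Set.univ.pi s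
    · rw [Set.indicator_of_mem hx]
      exact Finset.prod_congr rfl fun i _ => (Set.indicator_of_mem (hx i trivial) _).symm
    · rw [Set.indicator_of_notMem hx]
      obtain ⟨i, hi⟩ : ∃ i, x i ∉ s i := by simpa using hx
      exact (Finset.prod_eq_zero (Finset.mem_univ i) (Set.indicator_of_notMem hi _)).symm
  have hmeas (i : ι) : Measurable ((s i).indicator (f i)) := (hf i).indicator (hs i)
  rw [withDensity_apply _ (.univ_pi hs), ← lintegral_indicator (.univ_pi hs)]
  simp_rw [hind]
  rw [lintegral_prod_eq_prod_lintegral_of_indepFun _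
    (fun i (x : ∀ i, α i) => (s i).indicator (f i) (x i))
    (iIndepFun_pi fun i => (hmeas i).aemeasurable) fun i => (hmeas i).comp (measurable_pi_apply i)]
  refine Finset.prod_congr rfl fun i _ => ?_
  rw [withDensity_apply _ (hs i), ← lintegral_indicator (hs i),
    ← (measurePreserving_eval μ i).map_eq, lintegral_map (hmeas i) (measurable_pi_apply i)]

lemma gaussianReal_eq_withDensity (a b : ℝ) {v : ℝ≥0} (hv : v ≠ 0) :
    gaussianReal a v = (gaussianReal b v).withDensity
      fun x => ENNReal.ofReal (Real.exp ((a - b) * (x - (a + b) / 2) / v)) := by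
  rw [gaussianReal_of_var_ne_zero a hv, gaussianReal_of_var_ne_zero b hv,
    ← withDensity_mul _ (by fun_prop) (by fun_prop)]
  congr 1
  ext x
  rw [Pi.mul_apply, gaussianPDF, gaussianPDF,
    ← ENNReal.ofReal_mul (gaussianPDFReal_nonneg _ _ _), gaussianPDFReal, gaussianPDFReal,
    mul_assoc _ (Real.exp _), ← Real.exp_add]
  congr 3
  have : (v : ℝ) ≠ 0 := by exact_mod_cast hv
  field_simp
  ring

lemma pi_gaussianReal_eq_withDensity {ι : Type*} [Fintype ι] (a b : ι → ℝ) {v : ℝ≥0}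
    (hv : v ≠ 0) :
    (Measure.pi fun i => gaussianReal (a i) v) =
      (Measure.pi fun i => gaussianReal (b i) v).withDensity fun x =>
        ENNReal.ofReal (Real.exp ((∑ i, (a i - b i) * (x i - (a i + b i) / 2)) / v)) := by
  have h (i : ι) := gaussianReal_eq_withDensity (a i) (b i) hv
  have (i : ι) : SigmaFinite ((gaussianReal (b i) v).withDensity
      fun x => ENNReal.ofReal (Real.exp ((a i - b i) * (x - (a i + b i) / 2) / v))) := by
    rw [← h]; infer_instance
  simp_rw [h]
  rw [pi_withDensity _ (fun i => by fun_prop)]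
  congr 1
  ext x
  rw [← ENNReal.ofReal_prod_of_nonneg fun i _ => (Real.exp_pos _).le, ← Real.exp_sum,
    Finset.sum_div]

/-- Likelihood-ratio tests minimise the sum of the two error probabilities. -/
lemma measureReal_add_measureReal_compl_le {α : Type*} [MeasurableSpace α] {μ ν : Measure α}
    [IsFiniteMeasure μ] [IsFiniteMeasure ν] {f : α → ℝ≥0∞} (hμ : μ = ν.withDensity f)
    {H A : Set α} (hH : MeasurableSet H) (hA : MeasurableSet A) (hle : ∀ x ∈ H, f x ≤ 1)
    (hge : ∀ x ∉ H, 1 ≤ f x) :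
    μ.real H + ν.real Hᶜ ≤ μ.real A + ν.real Aᶜ := by
  have h₁ : μ.real (H \ A) ≤ ν.real (H \ A) := by
    refine ENNReal.toReal_mono (measure_ne_top _ _) ?_
    rw [hμ, withDensity_apply _ (hH.diff hA), ← setLIntegral_one]
    exact setLIntegral_mono measurable_one fun x hx => hle x hx.1
  have h₂ : ν.real (A \ H) ≤ μ.real (A \ H) := by
    refine ENNReal.toReal_mono (measure_ne_top _ _) ?_
    rw [hμ, withDensity_apply _ (hA.diff hH), ← setLIntegral_one]
    exact setLIntegral_mono' (hA.diff hH) fun x hx => hge x hx.2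
  have h₃ := measureReal_inter_add_sdiff (μ := μ) (s := H) hA
  have h₄ := measureReal_inter_add_sdiff (μ := μ) (s := A) hH
  have h₅ := measureReal_inter_add_sdiff (μ := ν) (s := H) hA
  have h₆ := measureReal_inter_add_sdiff (μ := ν) (s := A) hH
  rw [Set.inter_comm] at h₄ h₆
  rw [measureReal_compl hH, measureReal_compl hA]
  linarith

/-- The sum of the two error probabilities of any binary test between two Gaussian vectors with
covariance `σ² I` is at least `2 Q(‖a - b‖ / (2σ))`. -/
lemma two_mul_Qfun_le_pi_gaussianReal {ι : Type*} [Fintype ι] (a b : ι → ℝ) {σ D : ℝ}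
    (hσ : 0 < σ) (hD : 0 < D) (hab : ∑ i, (a i - b i) ^ 2 = D ^ 2) {A : Set (ι → ℝ)}
    (hA : MeasurableSet A) :
    2 * Qfun (D / (2 * σ)) ≤
      (Measure.pi fun i => gaussianReal (a i) (σ ^ 2).toNNReal).real A +
        (Measure.pi fun i => gaussianReal (b i) (σ ^ 2).toNNReal).real Aᶜ := by
  set T : (ι → ℝ) → ℝ := fun x => ∑ i, (a i - b i) * (x i - (a i + b i) / 2) with hT
  have hTm : Measurable T := by fun_prop
  have hv : (σ ^ 2).toNNReal ≠ 0 := by simpa using hσ.ne'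
  have hσv : (0 : ℝ) < (σ ^ 2).toNNReal := by simpa using hσ.ne'
  have hvar : (D ^ 2).toNNReal * (σ ^ 2).toNNReal = ((D * σ) ^ 2).toNNReal := by
    rw [mul_pow, Real.toNNReal_mul (sq_nonneg D)]
  have hQ : D ^ 2 / 2 / (D * σ) = D / (2 * σ) := by field_simp
  have hmean₁ : ∑ i, (a i - b i) * (a i - (a i + b i) / 2) = D ^ 2 / 2 := by
    rw [← hab, Finset.sum_div]; exact Finset.sum_congr rfl fun i _ => by ring
  have hmean₂ : ∑ i, (a i - b i) * (b i - (a i + b i) / 2) = -(D ^ 2 / 2) := by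
    rw [← hab, Finset.sum_div, ← Finset.sum_neg_distrib]
    exact Finset.sum_congr rfl fun i _ => by ring
  have h₁ : (Measure.pi fun i => gaussianReal (a i) (σ ^ 2).toNNReal).real (T ⁻¹' Set.Iic 0) =
      Qfun (D / (2 * σ)) := by
    rw [← map_measureReal_apply hTm measurableSet_Iic, pi_gaussianReal_map_sum_mul_sub, hab,
      hmean₁, hvar, gaussianReal_real_Iic_zero _ (mul_pos hD hσ), hQ]
  have h₂ : (Measure.pi fun i => gaussianReal (b i) (σ ^ 2).toNNReal).real (T ⁻¹' Set.Iic 0)ᶜ =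
      Qfun (D / (2 * σ)) := by
    rw [← Set.preimage_compl, Set.compl_Iic, ← map_measureReal_apply hTm measurableSet_Ioi,
      pi_gaussianReal_map_sum_mul_sub, hab, hmean₂, hvar,
      gaussianReal_real_Ioi_zero _ (mul_pos hD hσ), hQ]
  calc 2 * Qfun (D / (2 * σ)) = _ := by rw [two_mul]; nth_rw 1 [← h₁, ← h₂]
    _ ≤ _ := measureReal_add_measureReal_compl_le (pi_gaussianReal_eq_withDensity a b hv)
      (hTm measurableSet_Iic) hA (fun x hx => ?_) fun x hx => ?_
  · simpa using div_nonpos_of_nonpos_of_nonneg hx hσv.le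
  · have : 0 < T x := by simpa using hx
    simpa using (div_pos this hσv).le

lemma sum_bpsk_sub_sq {n : ℕ} (x c : Fin n → ZMod 2) :
    ∑ j, (bpsk (x j) - bpsk ((x + c) j)) ^ 2 = 4 * hammingNorm c := by
  have h (s t : ZMod 2) : (bpsk s - bpsk (s + t)) ^ 2 = if t ≠ 0 then 4 else 0 := by
    have h01 : ∀ r : ZMod 2, r = 0 ∨ r = 1 := by decide
    rcases h01 s with rfl | rfl <;> rcases h01 t with rfl | rfl <;>
      simp [bpsk, CharTwo.add_self_eq_zero] <;> norm_num
  simp_rw [Pi.add_apply, h, hammingNorm]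
  rw [Finset.sum_ite, Finset.sum_const_zero, add_zero, Finset.sum_const, nsmul_eq_mul, mul_comm]

lemma pi_gaussianReal_zero_map_const_add {ι : Type*} [Fintype ι] (a : ι → ℝ) (v : ℝ≥0) :
    (Measure.pi fun _ : ι => gaussianReal 0 v).map (fun z j => a j + z j) =
      Measure.pi fun j => gaussianReal (a j) v := by
  rw [Measure.pi_map_pi (f := fun j z => a j + z) (by fun_prop)]
  simp [gaussianReal_map_const_add]

/-- The two hypotheses `U = u` and `U = u + e` with `e i = 1` disagree in bit `i`. -/
lemma two_mul_Qfun_le_bit_error {n k : ℕ} {σ : ℝ} (hσ : 0 < σ)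
    (G : Matrix (Fin k) (Fin n) (ZMod 2)) {ψ : (Fin n → ℝ) → Fin k → ZMod 2} (hψ : Measurable ψ)
    {i : Fin k} {e : Fin k → ZMod 2} (he : e i = 1) (hpos : 0 < hammingNorm (Matrix.vecMul e G))
    (u : Fin k → ZMod 2) :
    2 * Qfun (Real.sqrt (hammingNorm (Matrix.vecMul e G)) / σ) ≤
      (Measure.pi fun j => gaussianReal (bpsk (Matrix.vecMul u G j)) (σ ^ 2).toNNReal).real
          {y | ψ y i ≠ u i} +
        (Measure.pi fun j => gaussianReal (bpsk (Matrix.vecMul (u + e) G j))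
          (σ ^ 2).toNNReal).real {y | ψ y i ≠ (u + e) i} := by
  set d := hammingNorm (Matrix.vecMul e G)
  have hd : (0 : ℝ) < d := by exact_mod_cast hpos
  have hsum : ∑ j, (bpsk (Matrix.vecMul u G j) - bpsk (Matrix.vecMul (u + e) G j)) ^ 2 =
      (2 * Real.sqrt d) ^ 2 := by
    rw [Matrix.add_vecMul, sum_bpsk_sub_sq, mul_pow, Real.sq_sqrt hd.le]
    norm_num [d]
  have hA : MeasurableSet {y | ψ y i ≠ u i} :=
    (measurable_pi_apply i).comp hψ (.of_discrete (s := {u i}ᶜ))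
  have hcompl : {y | ψ y i ≠ (u + e) i} = {y | ψ y i ≠ u i}ᶜ := by
    have hbit : ∀ s t : ZMod 2, s ≠ t + 1 ↔ ¬ s ≠ t := by decide
    ext y
    simpa [he] using hbit (ψ y i) (u i)
  rw [hcompl]
  convert two_mul_Qfun_le_pi_gaussianReal _ _ hσ (by positivity) hsum hA using 3
  field_simp

lemma channel_measure_bit_error {n k : ℕ} (σ : ℝ) (G : Matrix (Fin k) (Fin n) (ZMod 2))
    {ψ : (Fin n → ℝ) → Fin k → ZMod 2} (hψ : Measurable ψ) (i : Fin k) :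
    (((PMF.uniformOfFintype (Fin k → ZMod 2)).toMeasure).prod
        (Measure.pi fun _ : Fin n => gaussianReal 0 ((σ ^ 2).toNNReal))).real
        {ω | ψ (fun j => bpsk (Matrix.vecMul ω.1 G j) + ω.2 j) i ≠ ω.1 i} =
      (∑ u, (Measure.pi fun j => gaussianReal (bpsk (Matrix.vecMul u G j))
        (σ ^ 2).toNNReal).real {y | ψ y i ≠ u i}) / Fintype.card (Fin k → ZMod 2) := by
  have hY : Measurable fun ω : (Fin k → ZMod 2) × (Fin n → ℝ) =>
      fun j => bpsk (Matrix.vecMul ω.1 G j) + ω.2 j :=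
    measurable_from_prod_countable_right fun u => by fun_prop
  have hψi : Measurable fun y => ψ y i := (measurable_pi_apply i).comp hψ
  have hS : MeasurableSet {ω : (Fin k → ZMod 2) × (Fin n → ℝ) |
      ψ (fun j => bpsk (Matrix.vecMul ω.1 G j) + ω.2 j) i ≠ ω.1 i} :=
    (measurableSet_eq_fun (hψi.comp hY) ((measurable_pi_apply i).comp measurable_fst)).compl
  rw [Measure.real, Measure.prod_apply hS, lintegral_fintype, ENNReal.toReal_sum fun u _ =>
    ENNReal.mul_ne_top (measure_ne_top _ _) (measure_ne_top _ _), Finset.sum_div]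
  refine Finset.sum_congr rfl fun u _ => ?_
  have hA : MeasurableSet {y | ψ y i ≠ u i} := hψi (.of_discrete (s := {u i}ᶜ))
  rw [ENNReal.toReal_mul, PMF.toMeasure_apply_singleton _ _ (.singleton u),
    PMF.uniformOfFintype_apply, ENNReal.toReal_inv, ENNReal.toReal_natCast, div_eq_mul_inv,
    ← pi_gaussianReal_zero_map_const_add fun j => bpsk (Matrix.vecMul u G j),
    map_measureReal_apply (by fun_prop) hA]
  rfl

/-- (Theorem 2) For any binary linear block code transmitted with BPSK over an AWGN channel
with noise variance `σ²`, every (measurable) decoder `ψ` — in particular the bit-wise MAP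
decoder — satisfies `BER_ψ ≥ (1/k) ∑_{i=0}^{k-1} Q(√(d_{min,i}) / σ)`, where `d_{min,i}` is
the minimum Hamming weight of the codewords `uG` with `u_i = 1`. -/
theorem ber_lower_bound_dmin_i
    (n k : ℕ) (hk : 1 ≤ k) (hkn : k ≤ n) (σ : ℝ) (hσ : 0 < σ)
    -- generator matrix of rank `k`, i.e. with linearly independent rows
    (G : Matrix (Fin k) (Fin n) (ZMod 2))
    (hG : LinearIndependent (ZMod 2) (fun i => G i))
    -- `d_{min,i}` is the minimum Hamming weight of `uG` over `u` with `u_i = 1`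
    (dmini : Fin k → ℕ)
    (hdmini : ∀ i : Fin k, IsLeast {w : ℕ | ∃ u : Fin k → ZMod 2, u i = 1 ∧
        hammingNorm (Matrix.vecMul u G) = w} (dmini i))
    -- the underlying probability measure: `U` uniform, independent i.i.d. Gaussian noise
    (P : Measure ((Fin k → ZMod 2) × (Fin n → ℝ)))
    (hP : P = ((PMF.uniformOfFintype (Fin k → ZMod 2)).toMeasure).prod
        (Measure.pi fun _ : Fin n => gaussianReal 0 ((σ ^ 2).toNNReal)))
    -- the received vector `Y_j = (-1)^{(UG)_j} + Z_j`
    (Y : (Fin k → ZMod 2) × (Fin n → ℝ) → Fin n → ℝ)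
    (hY : Y = fun ω j => bpsk (Matrix.vecMul ω.1 G j) + ω.2 j)
    -- the decoder and its bit-error probability
    (ψ : (Fin n → ℝ) → Fin k → ZMod 2) (hψ : Measurable ψ)
    (BER : ℝ)
    (hBER : BER = (1 / (k : ℝ)) * ∑ i : Fin k, (P {ω | ψ (Y ω) i ≠ ω.1 i}).toReal) :
    (1 / (k : ℝ)) * ∑ i : Fin k, Qfun (Real.sqrt (dmini i : ℝ) / σ) ≤ BER := by
  subst hBER hP hY
  refine mul_le_mul_of_nonneg_left (Finset.sum_le_sum fun i _ => ?_) (by positivity)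
  obtain ⟨e, he, hw⟩ := (hdmini i).1
  have hpos : 0 < hammingNorm (Matrix.vecMul e G) := by
    refine hammingNorm_pos_iff.2 fun h => one_ne_zero (α := ZMod 2) ?_
    rw [← he, Matrix.vecMul_injective_iff.2 hG (h.trans (Matrix.zero_vecMul G).symm), Pi.zero_apply]
  rw [← hw]
  refine le_of_le_of_eq ?_ (channel_measure_bit_error σ G hψ i).symm
  set f : (Fin k → ZMod 2) → ℝ := fun u =>
    (Measure.pi fun j => gaussianReal (bpsk (Matrix.vecMul u G j)) (σ ^ 2).toNNReal).real
      {y | ψ y i ≠ u i}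
  have hpair : ∑ _u : Fin k → ZMod 2, _ ≤ ∑ u, (f u + f (Equiv.addRight e u)) :=
    Finset.sum_le_sum fun u _ => two_mul_Qfun_le_bit_error hσ G hψ he hpos u
  rw [Finset.sum_add_distrib, Equiv.sum_comp (Equiv.addRight e) f, Finset.sum_const,
    nsmul_eq_mul, Finset.card_univ] at hpair
  rw [le_div_iff₀ (by exact_mod_cast Fintype.card_pos)]
  linarith
end

section
/- (Corollary 6) Let the rows of the generator matrix G of a binary linear block code have Hamming weights w_0, w_1, …, w_{k-1}. Then under BPSK transmission over an AWGN channel with noise variance σ², every decoder ψ satisfies BER_ψ ≥ (1/k) ∑_{i=0}^{k-1} Q(√(w_i) / σ). -/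
open MeasureTheory ProbabilityTheory

section Helpers

open scoped ENNReal NNReal

/-- A product of Gaussian measures with nonzero variance has the product density. -/
lemma pi_gaussianReal_eq_withDensity_s9 {ι : Type*} [Fintype ι] (m : ι → ℝ) {v : ℝ≥0} (hv : v ≠ 0) :
    Measure.pi (fun j => gaussianReal (m j) v) =
      (volume : Measure (ι → ℝ)).withDensity
        (fun y => ENNReal.ofReal (∏ j, gaussianPDFReal (m j) v (y j))) := by
  refine Measure.pi_eq fun s hs => ?_
  rw [withDensity_apply _ (MeasurableSet.univ_pi hs)]
  simp_rw [gaussianReal_apply_eq_integral _ hv]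
  rw [← ENNReal.ofReal_prod_of_nonneg
      (fun i _ => integral_nonneg fun x => gaussianPDFReal_nonneg _ _ x),
    ← integral_fintype_prod_eq_prod (𝕜 := ℝ) (fun j => gaussianPDFReal (m j) v),
    ofReal_integral_eq_lintegral_ofReal, volume_pi, Measure.restrict_pi_pi]
  · exact Integrable.fintype_prod fun i => (integrable_gaussianPDFReal _ _).restrict
  · exact ae_of_all _ fun y => Finset.prod_nonneg fun j _ => gaussianPDFReal_nonneg _ _ _

/-- Among all tests between two measures with densities, the likelihood-ratio test has the
smallest total error. -/
lemma withDensity_likelihood_test_le {α : Type*} [MeasurableSpace α] (μ : Measure α)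
    {f g : α → ℝ≥0∞} {A H : Set α} (hA : MeasurableSet A) (hH : MeasurableSet H)
    (hfg : ∀ y ∈ H, f y ≤ g y) (hgf : ∀ y ∈ Hᶜ, g y ≤ f y) :
    μ.withDensity f H + μ.withDensity g Hᶜ ≤ μ.withDensity f A + μ.withDensity g Aᶜ := by
  have key : ∀ (f g : α → ℝ≥0∞) (S : Set α), MeasurableSet S → (∀ y ∈ S, f y ≤ g y) →
      μ.withDensity f S ≤ μ.withDensity g S := by
    intro f g S hS h
    rw [withDensity_apply _ hS, withDensity_apply _ hS]
    exact setLIntegral_mono' hS h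
  have h1 := key f g (H \ A) (hH.diff hA) fun y hy => hfg y hy.1
  have h2 := key g f (Hᶜ ∩ A) (hH.compl.inter hA) fun y hy => hgf y hy.1
  rw [← measure_inter_add_sdiff H hA, ← measure_inter_add_sdiff Hᶜ hA,
    ← measure_inter_add_sdiff A hH, ← measure_inter_add_sdiff Aᶜ hH]
  have e1 : H \ A = Aᶜ ∩ H := by ext; simp [and_comm]
  have e2 : Hᶜ ∩ A = A \ H := by ext; simp [and_comm]
  have e3 : Hᶜ \ A = Aᶜ \ H := by ext; simp [and_comm]
  rw [e1] at h1 ⊢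
  rw [e2] at h2 ⊢
  rw [e3, Set.inter_comm H A]
  calc _ ≤ (μ.withDensity f (A ∩ H) + μ.withDensity g (Aᶜ ∩ H)) +
        (μ.withDensity f (A \ H) + μ.withDensity g (Aᶜ \ H)) := by gcongr
    _ = _ := by ring

lemma prod_gaussianPDFReal_le {ι : Type*} [Fintype ι] (a b y : ι → ℝ) (v : ℝ≥0)
    (h : ∑ j, (y j - b j) ^ 2 ≤ ∑ j, (y j - a j) ^ 2) :
    ∏ j, gaussianPDFReal (a j) v (y j) ≤ ∏ j, gaussianPDFReal (b j) v (y j) := by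
  simp_rw [gaussianPDFReal, Finset.prod_mul_distrib, ← Real.exp_sum, ← Finset.sum_div,
    Finset.sum_neg_distrib]
  gcongr

/-- Total error of any test between two shifted Gaussian product measures is at least that of the
nearest-mean test. -/
lemma pi_gaussianReal_test_le {ι : Type*} [Fintype ι] (a b : ι → ℝ) {v : ℝ≥0} (hv : v ≠ 0)
    {A : Set (ι → ℝ)} (hA : MeasurableSet A) {H : Set (ι → ℝ)}
    (hH : H = {y | ∑ j, (y j - b j) ^ 2 ≤ ∑ j, (y j - a j) ^ 2}) :
    Measure.pi (fun j => gaussianReal (a j) v) H + Measure.pi (fun j => gaussianReal (b j) v) Hᶜ ≤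
      Measure.pi (fun j => gaussianReal (a j) v) A +
        Measure.pi (fun j => gaussianReal (b j) v) Aᶜ := by
  subst hH
  rw [pi_gaussianReal_eq_withDensity_s9 a hv, pi_gaussianReal_eq_withDensity_s9 b hv]
  refine withDensity_likelihood_test_le _ hA ?_ ?_ ?_
  · exact measurableSet_le (by fun_prop) (by fun_prop)
  · exact fun y hy => ENNReal.ofReal_le_ofReal (prod_gaussianPDFReal_le a b y v hy)
  · intro y hy
    exact ENNReal.ofReal_le_ofReal (prod_gaussianPDFReal_le b a y v (le_of_not_ge hy))

lemma ofReal_Qfun (x : ℝ) : ENNReal.ofReal (Qfun x) = gaussianReal 0 1 (Set.Ioi x) := by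
  rw [gaussianReal_apply_eq_integral _ one_ne_zero]
  simp [Qfun, gaussianPDFReal]

/-- A linear functional of i.i.d. centered Gaussians is Gaussian. -/
lemma map_sum_mul_pi_gaussianReal {ι : Type*} [Fintype ι] (c : ι → ℝ) (v : ℝ≥0) :
    (Measure.pi fun _ : ι => gaussianReal 0 v).map (fun z => ∑ j, c j * z j) =
      gaussianReal 0 ((∑ j, c j ^ 2).toNNReal * v) := by
  let L : StrongDual ℝ (ι → ℝ) := ∑ j, c j • ContinuousLinearMap.proj j
  have hμ : IsGaussian (Measure.pi fun _ : ι => gaussianReal 0 v) := by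
    have h := iIndepFun.hasGaussianLaw (P := Measure.pi fun _ : ι => gaussianReal 0 v)
      (X := fun i z => z i)
      (fun i => ⟨by rw [(measurePreserving_eval _ i).map_eq]; infer_instance⟩)
      (iIndepFun_pi (X := fun _ x => x) fun _ => aemeasurable_id')
    simpa using h.isGaussian_map
  have hL : (fun z : ι → ℝ => ∑ j, c j * z j) = L := by
    ext z; simp [L]
  rw [hL, IsGaussian.map_eq_gaussianReal]
  congr 1
  · rw [← hL, integral_finsetSum]
    · simp [integral_const_mul, integral_eval]
    · exact fun i _ => (integrable_eval IsGaussian.integrable_id).const_mul _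
  · have : (L : (ι → ℝ) → ℝ) = ∑ j, fun z : ι → ℝ => (fun x => c j * x) (z j) := by
      rw [← hL]; ext z; simp
    rw [this, variance_sum_pi]
    · have hvar : ∀ j, Var[fun x => c j * x; gaussianReal 0 v] = c j ^ 2 * v := fun j => by
        rw [variance_const_mul, variance_fun_id_gaussianReal]
      simp_rw [hvar, ← Finset.sum_mul]
      rw [Real.toNNReal_mul (by positivity), Real.toNNReal_coe]
    · exact fun i => IsGaussian.memLp_two_id.const_mul _

lemma pi_gaussianReal_tail {ι : Type*} [Fintype ι] (c : ι → ℝ) {σ : ℝ} (hσ : 0 < σ)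
    {w : ℝ} (hw : 0 < w) (hc : ∑ j, c j ^ 2 = 4 * w) :
    (Measure.pi fun _ : ι => gaussianReal 0 (σ ^ 2).toNNReal)
      {z | 2 * w < ∑ j, c j * z j} = ENNReal.ofReal (Qfun (√w / σ)) := by
  have h1 : gaussianReal 0 ((∑ j, c j ^ 2).toNNReal * (σ ^ 2).toNNReal) =
      (gaussianReal 0 1).map (fun x => (2 * √w * σ) * x) := by
    rw [gaussianReal_map_const_mul]
    congr 1
    · simp
    · ext
      simp [hc, hw.le, mul_pow, Real.sq_sqrt hw.le, sq_nonneg]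
      left; left; norm_num
  have h2 : {z : ι → ℝ | 2 * w < ∑ j, c j * z j} =
      (fun z => ∑ j, c j * z j) ⁻¹' Set.Ioi (2 * w) := rfl
  rw [h2, ← Measure.map_apply (by fun_prop) measurableSet_Ioi, map_sum_mul_pi_gaussianReal, h1,
    Measure.map_apply (by fun_prop) measurableSet_Ioi, ofReal_Qfun]
  congr 1
  ext x
  simp only [Set.mem_preimage, Set.mem_Ioi]
  rw [div_lt_iff₀ hσ]
  have : 2 * w = 2 * √w * √w := by rw [mul_assoc, Real.mul_self_sqrt hw.le]
  rw [this, mul_assoc (2 * √w), mul_lt_mul_iff_right₀ (by positivity), mul_comm σ]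

/-- Total error probability of any test between two means at squared distance `4 * w`. -/
lemma two_mul_Qfun_le_test {ι : Type*} [Fintype ι] (a b : ι → ℝ) {σ : ℝ} (hσ : 0 < σ)
    {w : ℝ} (hw : 0 < w) (hab : ∑ j, (a j - b j) ^ 2 = 4 * w)
    {A : Set (ι → ℝ)} (hA : MeasurableSet A) :
    2 * ENNReal.ofReal (Qfun (√w / σ)) ≤
      (Measure.pi fun _ : ι => gaussianReal 0 (σ ^ 2).toNNReal) {z | (fun j => a j + z j) ∈ A} +
      (Measure.pi fun _ : ι => gaussianReal 0 (σ ^ 2).toNNReal) {z | (fun j => b j + z j) ∉ A} := by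
  have hv : (σ ^ 2).toNNReal ≠ 0 := by simpa using hσ.ne'
  have shift : ∀ (m : ι → ℝ) {S : Set (ι → ℝ)}, MeasurableSet S →
      Measure.pi (fun j => gaussianReal (m j) (σ ^ 2).toNNReal) S =
        (Measure.pi fun _ : ι => gaussianReal 0 (σ ^ 2).toNNReal)
          {z | (fun j => m j + z j) ∈ S} := by
    intro m S hS
    have : Measure.pi (fun j => gaussianReal (m j) (σ ^ 2).toNNReal) =
        (Measure.pi fun _ : ι => gaussianReal 0 (σ ^ 2).toNNReal).map
          (fun z j => m j + z j) := by
      rw [Measure.pi_map_pi (f := fun j x => m j + x) (fun _ => by fun_prop)]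
      simp [gaussianReal_map_const_add]
    rw [this, Measure.map_apply (by fun_prop) hS]
    rfl
  set H := {y : ι → ℝ | ∑ j, (y j - b j) ^ 2 ≤ ∑ j, (y j - a j) ^ 2} with hH
  have hHm : MeasurableSet H := measurableSet_le (by fun_prop) (by fun_prop)
  have key := pi_gaussianReal_test_le a b hv hA hH
  rw [shift a hHm, shift b hHm.compl, shift a hA, shift b hA.compl] at key
  refine le_trans ?_ key
  have ha := pi_gaussianReal_tail (fun j => b j - a j) hσ hw
    (by rw [← hab]; exact Finset.sum_congr rfl fun j _ => by ring)
  have hb := pi_gaussianReal_tail (fun j => a j - b j) hσ hw hab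
  rw [two_mul]
  refine add_le_add (ha.symm.le.trans (measure_mono ?_)) (hb.symm.le.trans (measure_mono ?_))
  · intro z hz
    simp only [Set.mem_ofPred_eq, hH] at hz ⊢
    have e : ∀ j, (a j + z j - b j) ^ 2 =
        (a j - b j) ^ 2 - 2 * ((b j - a j) * z j) + (a j + z j - a j) ^ 2 := fun j => by ring
    simp_rw [e, Finset.sum_add_distrib, Finset.sum_sub_distrib, ← Finset.mul_sum]
    linarith
  · intro z hz
    simp only [Set.mem_ofPred_eq, hH, Set.mem_compl_iff, not_le] at hz ⊢
    have e : ∀ j, (b j + z j - a j) ^ 2 =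
        (a j - b j) ^ 2 - 2 * ((a j - b j) * z j) + (b j + z j - b j) ^ 2 := fun j => by ring
    simp_rw [e, Finset.sum_add_distrib, Finset.sum_sub_distrib, ← Finset.mul_sum]
    linarith

lemma sum_sq_bpsk_sub_bpsk_add {ι : Type*} [Fintype ι] (x g : ι → ZMod 2) :
    ∑ j, (bpsk (x j) - bpsk ((x + g) j)) ^ 2 = 4 * (hammingNorm g : ℝ) := by
  have h : ∀ p q : ZMod 2, (bpsk p - bpsk (p + q)) ^ 2 = if q ≠ 0 then 4 else 0 := by
    intro p q
    have h2 : (1 : ZMod 2) + 1 = 0 := by decide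
    have hcases : ∀ t : ZMod 2, t = 0 ∨ t = 1 := by decide
    rcases hcases p with rfl | rfl <;> rcases hcases q with rfl | rfl <;>
      simp only [bpsk, add_zero, zero_add, h2] <;> norm_num
  simp_rw [Pi.add_apply, h, hammingNorm, ← Finset.sum_filter]
  simp [mul_comm]

/-- The probability of an error in bit `i` when transmitting a uniformly random codeword. -/
lemma ofReal_Qfun_le_bit_error {n k : ℕ} {σ : ℝ} (hσ : 0 < σ)
    (G : Matrix (Fin k) (Fin n) (ZMod 2)) (i : Fin k) (hGi : G i ≠ 0)
    {ψ : (Fin n → ℝ) → Fin k → ZMod 2} (hψ : Measurable ψ) :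
    ENNReal.ofReal (Qfun (√(hammingNorm (G i) : ℝ) / σ)) ≤
      (((PMF.uniformOfFintype (Fin k → ZMod 2)).toMeasure).prod
        (Measure.pi fun _ : Fin n => gaussianReal 0 ((σ ^ 2).toNNReal)))
      {ω | ψ (fun j => bpsk (Matrix.vecMul ω.1 G j) + ω.2 j) i ≠ ω.1 i} := by
  set μ := Measure.pi fun _ : Fin n => gaussianReal 0 ((σ ^ 2).toNNReal)
  set q := ENNReal.ofReal (Qfun (√(hammingNorm (G i) : ℝ) / σ))
  set N : ℝ≥0∞ := (Fintype.card (Fin k → ZMod 2) : ℝ≥0∞)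
  have hw : (0 : ℝ) < hammingNorm (G i) := by
    exact_mod_cast hammingNorm_pos_iff.mpr hGi
  have hψi : Measurable fun y => ψ y i := (measurable_pi_apply i).comp hψ
  have hY : Measurable fun ω : (Fin k → ZMod 2) × (Fin n → ℝ) =>
      fun j => bpsk (Matrix.vecMul ω.1 G j) + ω.2 j := by
    refine measurable_pi_lambda _ fun j => Measurable.add ?_ (by fun_prop)
    exact (measurable_of_countable fun u : Fin k → ZMod 2 => bpsk (Matrix.vecMul u G j)).comp
      measurable_fst
  have hS : MeasurableSet {ω : (Fin k → ZMod 2) × (Fin n → ℝ) |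
      ψ (fun j => bpsk (Matrix.vecMul ω.1 G j) + ω.2 j) i ≠ ω.1 i} :=
    (measurableSet_eq_fun (hψi.comp hY) ((measurable_pi_apply i).comp measurable_fst)).compl
  let p : (Fin k → ZMod 2) → ℝ≥0∞ := fun u =>
    μ {z | ψ (fun j => bpsk (Matrix.vecMul u G j) + z j) i ≠ u i}
  have hp : ∀ u, 2 * q ≤ p u + p (u + Pi.single i 1) := by
    intro u
    have hA : MeasurableSet {y | ψ y i ≠ u i} :=
      (measurableSet_eq_fun hψi measurable_const).compl
    have hvec : Matrix.vecMul (u + Pi.single i 1) G = Matrix.vecMul u G + G i := by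
      rw [Matrix.add_vecMul, Matrix.single_one_vecMul]; rfl
    have := two_mul_Qfun_le_test (fun j => bpsk (Matrix.vecMul u G j))
      (fun j => bpsk ((Matrix.vecMul u G + G i) j)) hσ hw (sum_sq_bpsk_sub_bpsk_add _ _) hA
    refine this.trans_eq ?_
    simp only [p, hvec]
    congr 2
    ext z
    have flip : ∀ s t : ZMod 2, ¬ s ≠ t ↔ s ≠ t + 1 := by decide
    simpa using flip _ _
  have hsum : N * (2 * q) ≤ 2 * ∑ u, p u := by
    have h2 : 2 * ∑ u, p u = ∑ u, (p u + p (u + Pi.single i 1)) := by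
      rw [Finset.sum_add_distrib, two_mul]
      congr 1
      exact (Equiv.sum_comp (Equiv.addRight (Pi.single i 1)) p).symm
    rw [h2]
    calc N * (2 * q) = ∑ _u : Fin k → ZMod 2, 2 * q := by simp [N]
      _ ≤ _ := Finset.sum_le_sum fun u _ => hp u
  have hP : ((PMF.uniformOfFintype (Fin k → ZMod 2)).toMeasure.prod μ)
      {ω | ψ (fun j => bpsk (Matrix.vecMul ω.1 G j) + ω.2 j) i ≠ ω.1 i} = (∑ u, p u) * N⁻¹ := by
    rw [Measure.prod_apply hS, lintegral_fintype, Finset.sum_mul]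
    refine Finset.sum_congr rfl fun u _ => ?_
    rw [PMF.toMeasure_apply_singleton _ _ (measurableSet_singleton u),
      PMF.uniformOfFintype_apply]
    rfl
  rw [hP, ← div_eq_mul_inv, ENNReal.le_div_iff_mul_le (by simp [N]) (by simp [N])]
  rw [mul_left_comm, ENNReal.mul_le_mul_iff_right (by simp) (by simp)] at hsum
  rwa [mul_comm]

end Helpers

/-- (Corollary 6) Let the rows of the generator matrix `G` of a binary linear block code
have Hamming weights `w_0, …, w_{k-1}`. Then under BPSK transmission over an AWGN channel
with noise variance `σ²`, every (measurable) decoder `ψ` satisfies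
`BER_ψ ≥ (1/k) ∑_{i=0}^{k-1} Q(√(w_i) / σ)`. -/
theorem ber_lower_bound_row_weights
    (n k : ℕ) (hk : 1 ≤ k) (hkn : k ≤ n) (σ : ℝ) (hσ : 0 < σ)
    -- generator matrix of rank `k`, i.e. with linearly independent rows
    (G : Matrix (Fin k) (Fin n) (ZMod 2))
    (hG : LinearIndependent (ZMod 2) (fun i => G i))
    -- the row weights of `G`
    (w : Fin k → ℕ) (hw : ∀ i, w i = hammingNorm (G i))
    -- the underlying probability measure: `U` uniform, independent i.i.d. Gaussian noise
    (P : Measure ((Fin k → ZMod 2) × (Fin n → ℝ)))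
    (hP : P = ((PMF.uniformOfFintype (Fin k → ZMod 2)).toMeasure).prod
        (Measure.pi fun _ : Fin n => gaussianReal 0 ((σ ^ 2).toNNReal)))
    -- the received vector `Y_j = (-1)^{(UG)_j} + Z_j`
    (Y : (Fin k → ZMod 2) × (Fin n → ℝ) → Fin n → ℝ)
    (hY : Y = fun ω j => bpsk (Matrix.vecMul ω.1 G j) + ω.2 j)
    -- the decoder and its bit-error probability
    (ψ : (Fin n → ℝ) → Fin k → ZMod 2) (hψ : Measurable ψ)
    (BER : ℝ)
    (hBER : BER = (1 / (k : ℝ)) * ∑ i : Fin k, (P {ω | ψ (Y ω) i ≠ ω.1 i}).toReal) :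
    (1 / (k : ℝ)) * ∑ i : Fin k, Qfun (Real.sqrt (w i : ℝ) / σ) ≤ BER := by
  subst hBER hY hP
  gcongr with i
  rw [hw i]
  refine (ENNReal.ofReal_le_iff_le_toReal (measure_ne_top _ _)).mp ?_
  exact ofReal_Qfun_le_bit_error hσ G i (hG.ne_zero i) hψ
end

section
/- Let M ≥ 1, let A = {00, 10} ⊆ F_2^2 and B = {00, 11} ⊆ F_2^2, and let C = A × B^M ⊆ F_2^{2(M+1)} be the code whose codewords are concatenations (c_0, c_1, …, c_M) with c_0 ∈ A and c_i ∈ B for 1 ≤ i ≤ M, with the M+1 information bits determining the M+1 components independently and uniformly. Under BPSK transmission over an AWGN channel with noise variance σ², the minimal achievable bit-error probability over all decoders equals (1/(M+1)) Q(1/σ) + (M/(M+1)) Q(√2/σ). -/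
open MeasureTheory ProbabilityTheory

/-- The encoder of the code `C = A × B^M` with `A = {00, 10}` and `B = {00, 11}`:
the `k = M+1` information bits determine the `M+1` two-bit components independently;
bit `u_0` is encoded as `(u_0, 0) ∈ A` and bit `u_i`, `1 ≤ i ≤ M`, as `(u_i, u_i) ∈ B`.
Coordinates are indexed by `Fin (M+1) × Fin 2` (so `n = 2(M+1)`). -/
def encAB (M : ℕ) (u : Fin (M + 1) → ZMod 2) : Fin (M + 1) × Fin 2 → ZMod 2 :=
  fun c => if c.1 = 0 ∧ c.2 = 1 then 0 else u c.1

open scoped ENNReal NNReal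

/-- A product of measures with densities has the product density. -/
lemma pi_withDensity_eq {ι : Type*} [Fintype ι] {X : ι → Type*} [∀ i, MeasurableSpace (X i)]
    (μ : ∀ i, Measure (X i)) [∀ i, IsProbabilityMeasure (μ i)] (f : ∀ i, X i → ℝ≥0∞)
    (hf : ∀ i, Measurable (f i)) [∀ i, SigmaFinite ((μ i).withDensity (f i))] :
    Measure.pi (fun i => (μ i).withDensity (f i)) =
      (Measure.pi μ).withDensity (fun x => ∏ i, f i (x i)) := by
  refine Measure.pi_eq fun s hs => ?_
  have hind : iIndepFun (fun i (x : ∀ i, X i) => (s i).indicator (f i) (x i)) (Measure.pi μ) :=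
    iIndepFun_pi fun i => ((hf i).indicator (hs i)).aemeasurable
  rw [withDensity_apply _ (MeasurableSet.univ_pi hs),
    ← lintegral_indicator (MeasurableSet.univ_pi hs)]
  have hprod : (Set.univ.pi s).indicator (fun x => ∏ i, f i (x i)) =
      fun x => ∏ i, (s i).indicator (f i) (x i) := by
    classical
    ext x
    by_cases hx : x ∈ Set.univ.pi s
    · rw [Set.indicator_of_mem hx]
      exact Finset.prod_congr rfl fun i _ => (Set.indicator_of_mem (hx i trivial) _).symm
    · rw [Set.indicator_of_notMem hx]
      simp only [Set.mem_pi, Set.mem_univ, true_implies, not_forall] at hx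
      obtain ⟨i, hi⟩ := hx
      exact (Finset.prod_eq_zero (Finset.mem_univ i) (Set.indicator_of_notMem hi _)).symm
  rw [hprod, lintegral_prod_eq_prod_lintegral_of_indepFun _ _ hind
    fun i => ((hf i).indicator (hs i)).comp (measurable_pi_apply i)]
  refine Finset.prod_congr rfl fun i _ => ?_
  rw [withDensity_apply _ (hs i), ← lintegral_indicator (hs i),
    ← (measurePreserving_eval μ i).lintegral_comp ((hf i).indicator (hs i))]

/-- The likelihood ratio of `N(m, v)` with respect to `N(0, v)`. -/
noncomputable def gaussianLikelihoodRatio (v : ℝ≥0) (m x : ℝ) : ℝ≥0∞ :=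
  ENNReal.ofReal (Real.exp ((m * x - m ^ 2 / 2) / v))

lemma measurable_gaussianLikelihoodRatio (v : ℝ≥0) (m : ℝ) :
    Measurable (gaussianLikelihoodRatio v m) := by
  unfold gaussianLikelihoodRatio
  fun_prop

lemma withDensity_gaussianLikelihoodRatio {v : ℝ≥0} (hv : v ≠ 0) (m : ℝ) :
    (gaussianReal 0 v).withDensity (gaussianLikelihoodRatio v m) = gaussianReal m v := by
  rw [gaussianReal_of_var_ne_zero _ hv, gaussianReal_of_var_ne_zero _ hv,
    ← withDensity_mul _ (measurable_gaussianPDF 0 v) (measurable_gaussianLikelihoodRatio v m)]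
  congr 1
  ext x
  have hv' : (v : ℝ) ≠ 0 := by exact_mod_cast hv
  rw [Pi.mul_apply, gaussianLikelihoodRatio, gaussianPDF, gaussianPDF,
    ← ENNReal.ofReal_mul (gaussianPDFReal_nonneg _ _ _), gaussianPDFReal, gaussianPDFReal,
    mul_assoc, ← Real.exp_add]
  congr 3
  field_simp
  ring

lemma pi_gaussianReal_map_const_add {ι : Type*} [Fintype ι] {v : ℝ≥0} (hv : v ≠ 0) (m : ι → ℝ) :
    (Measure.pi fun _ : ι => gaussianReal 0 v).map (fun z c => m c + z c) =
      (Measure.pi fun _ : ι => gaussianReal 0 v).withDensity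
        (fun y => ∏ c, gaussianLikelihoodRatio v (m c) (y c)) := by
  have : ∀ c, IsProbabilityMeasure
      ((gaussianReal 0 v).withDensity (gaussianLikelihoodRatio v (m c))) := fun c => by
    rw [withDensity_gaussianLikelihoodRatio hv]; infer_instance
  have h := pi_withDensity_eq (fun _ : ι => gaussianReal 0 v)
    (fun c => gaussianLikelihoodRatio v (m c)) fun c => measurable_gaussianLikelihoodRatio v _
  rw [← h]
  have : ∀ c, SigmaFinite ((gaussianReal 0 v).map (m c + ·)) := fun c => by
    rw [gaussianReal_map_const_add]; infer_instance
  have hmap := Measure.pi_map_pi (μ := fun _ : ι => gaussianReal 0 v)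
    (f := fun c x => m c + x) fun c => by fun_prop
  rw [hmap]
  simp_rw [gaussianReal_map_const_add, withDensity_gaussianLikelihoodRatio hv, zero_add]

lemma gaussianReal_zero_one_Ioi (x : ℝ) :
    gaussianReal 0 1 (Set.Ioi x) = ENNReal.ofReal (Qfun x) := by
  rw [gaussianReal_apply_eq_integral _ one_ne_zero, Qfun]
  simp [gaussianPDFReal]

lemma gaussianReal_zero_Ioi {v : ℝ≥0} (hv : v ≠ 0) (x : ℝ) :
    gaussianReal 0 v (Set.Ioi x) = ENNReal.ofReal (Qfun (x / √v)) := by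
  have hv0 : 0 < (v : ℝ) := by exact_mod_cast pos_iff_ne_zero.mpr hv
  have h := gaussianReal_map_const_mul (μ := 0) (v := 1) (√v)
  have hv' : NNReal.mk (√v ^ 2) (sq_nonneg _) * 1 = v := by
    ext; simp
  rw [mul_zero, hv'] at h
  rw [← h, Measure.map_apply (by fun_prop) measurableSet_Ioi, ← gaussianReal_zero_one_Ioi]
  congr 1
  ext t
  simp [div_lt_iff₀ (Real.sqrt_pos.mpr hv0), mul_comm]

lemma gaussianReal_zero_Ici {v : ℝ≥0} (hv : v ≠ 0) (x : ℝ) :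
    gaussianReal 0 v (Set.Ici x) = ENNReal.ofReal (Qfun (x / √v)) := by
  have := nullSingletonClass_gaussianReal (μ := 0) hv
  rw [← gaussianReal_zero_Ioi hv, measure_congr Ioi_ae_eq_Ici]

lemma gaussianReal_zero_Iio_neg {v : ℝ≥0} (hv : v ≠ 0) (x : ℝ) :
    gaussianReal 0 v (Set.Iio (-x)) = ENNReal.ofReal (Qfun (x / √v)) := by
  have h := gaussianReal_map_neg (μ := 0) (v := v)
  rw [neg_zero] at h
  rw [← h, Measure.map_apply (by fun_prop) measurableSet_Iio, ← gaussianReal_zero_Ioi hv]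
  congr 1
  ext t
  simp

lemma Qfun_nonneg (x : ℝ) : 0 ≤ Qfun x :=
  integral_nonneg fun _ => by positivity

lemma bpsk_sq (b : ZMod 2) : bpsk b ^ 2 = 1 := by
  unfold bpsk; split_ifs <;> norm_num

/-- The sufficient statistic for information bit `i`. -/
noncomputable def bitStatistic (M : ℕ) (i : Fin (M + 1)) (y : Fin (M + 1) × Fin 2 → ℝ) : ℝ :=
  if i = 0 then y (i, 0) else y (i, 0) + y (i, 1)

/-- The number of channel uses carrying information bit `i`. -/
noncomputable def bitWeight (M : ℕ) (i : Fin (M + 1)) : ℝ≥0 := if i = 0 then 1 else 2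

/-- The bitwise maximum a posteriori decoder. -/
noncomputable def mapDecoder (M : ℕ) (y : Fin (M + 1) × Fin 2 → ℝ) (i : Fin (M + 1)) : ZMod 2 :=
  if 0 ≤ bitStatistic M i y then 0 else 1

lemma measurable_bitStatistic (M : ℕ) (i : Fin (M + 1)) : Measurable (bitStatistic M i) := by
  unfold bitStatistic
  split_ifs <;> fun_prop

lemma measurable_mapDecoder (M : ℕ) : Measurable (mapDecoder M) :=
  measurable_pi_lambda _ fun i => Measurable.ite
    (measurableSet_le measurable_const (measurable_bitStatistic M i))
    measurable_const measurable_const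

lemma bitStatistic_codeword_add (M : ℕ) (i : Fin (M + 1)) (u : Fin (M + 1) → ZMod 2)
    (z : Fin (M + 1) × Fin 2 → ℝ) :
    bitStatistic M i (fun c => bpsk (encAB M u c) + z c) =
      bitWeight M i * bpsk (u i) + bitStatistic M i z := by
  by_cases hi : i = 0
  · simp [bitStatistic, bitWeight, encAB, hi]
  · simp [bitStatistic, bitWeight, encAB, hi]
    ring

lemma map_bitStatistic (M : ℕ) (i : Fin (M + 1)) (v : ℝ≥0) :
    (Measure.pi fun _ : Fin (M + 1) × Fin 2 => gaussianReal 0 v).map (bitStatistic M i) =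
      gaussianReal 0 (bitWeight M i * v) := by
  have heval : ∀ c, (Measure.pi fun _ : Fin (M + 1) × Fin 2 => gaussianReal 0 v).map
      (fun z => z c) = gaussianReal 0 v := fun c =>
    (measurePreserving_eval (fun _ : Fin (M + 1) × Fin 2 => gaussianReal 0 v) c).map_eq
  by_cases hi : i = 0
  · have h : bitStatistic M i = fun z => z (i, 0) := by
      ext z; simp [bitStatistic, hi]
    rw [h, heval, bitWeight, if_pos hi, one_mul]
  · have h : bitStatistic M i = (fun z => z (i, 0)) + fun z => z (i, 1) := by
      ext z; simp [bitStatistic, hi]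
    have hind := (iIndepFun_pi (μ := fun _ : Fin (M + 1) × Fin 2 => gaussianReal 0 v)
      (X := fun _ x => x) fun _ => aemeasurable_id).indepFun
      (i := (i, 0)) (j := (i, 1)) (by simp)
    rw [h, gaussianReal_add_gaussianReal_of_indepFun hind (heval _) (heval _),
      bitWeight, if_neg hi, two_mul, zero_add]

/-- The conditional error probability of the MAP decoder on bit `i`. -/
lemma measure_mapDecoder_ne (M : ℕ) {v : ℝ≥0} (hv : v ≠ 0) (i : Fin (M + 1))
    (u : Fin (M + 1) → ZMod 2) :
    (Measure.pi fun _ : Fin (M + 1) × Fin 2 => gaussianReal 0 v)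
        {z | mapDecoder M (fun c => bpsk (encAB M u c) + z c) i ≠ u i} =
      ENNReal.ofReal (Qfun (bitWeight M i / √(bitWeight M i * v : ℝ≥0))) := by
  have hw : bitWeight M i * v ≠ 0 := by
    refine mul_ne_zero ?_ hv
    unfold bitWeight; split_ifs <;> norm_num
  simp only [mapDecoder, bitStatistic_codeword_add]
  obtain hu | hu : u i = 0 ∨ u i = 1 := by generalize u i = b; revert b; decide
  · rw [← gaussianReal_zero_Iio_neg hw, ← map_bitStatistic,
      Measure.map_apply (measurable_bitStatistic M i) measurableSet_Iio]
    congr 1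
    ext z
    simp [hu, bpsk, lt_neg_iff_add_neg, add_comm]
  · rw [← gaussianReal_zero_Ici hw, ← map_bitStatistic,
      Measure.map_apply (measurable_bitStatistic M i) measurableSet_Ici]
    congr 1
    ext z
    simp [hu, bpsk]

/-- The likelihood of the received vector `y` given the information vector `u`. -/
noncomputable def codewordLikelihood (M : ℕ) (v : ℝ≥0) (u : Fin (M + 1) → ZMod 2)
    (y : Fin (M + 1) × Fin 2 → ℝ) : ℝ≥0∞ :=
  ∏ c, gaussianLikelihoodRatio v (bpsk (encAB M u c)) (y c)

lemma measurable_codewordLikelihood (M : ℕ) (v : ℝ≥0) (u : Fin (M + 1) → ZMod 2) :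
    Measurable (codewordLikelihood M v u) :=
  Finset.measurable_prod _ fun c _ =>
    (measurable_gaussianLikelihoodRatio v _).comp (measurable_pi_apply c)

/-- Flipping a bit that disagrees with the MAP decision does not decrease the likelihood. -/
lemma codewordLikelihood_le_flip (M : ℕ) (v : ℝ≥0) (i : Fin (M + 1))
    (u : Fin (M + 1) → ZMod 2) (y : Fin (M + 1) × Fin 2 → ℝ) (h : mapDecoder M y i ≠ u i) :
    codewordLikelihood M v u y ≤ codewordLikelihood M v (u + Pi.single i 1) y := by
  unfold codewordLikelihood
  rw [Fintype.prod_prod_type, Fintype.prod_prod_type]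
  refine Finset.prod_le_prod' fun j _ => ?_
  by_cases hj : j = i
  · subst hj
    simp only [Fin.prod_univ_two, gaussianLikelihoodRatio, bpsk_sq]
    rw [← ENNReal.ofReal_mul (Real.exp_nonneg _), ← ENNReal.ofReal_mul (Real.exp_nonneg _),
      ← Real.exp_add, ← Real.exp_add, ← add_div, ← add_div]
    refine ENNReal.ofReal_le_ofReal (Real.exp_le_exp.mpr ?_)
    refine div_le_div_of_nonneg_right ?_ v.coe_nonneg
    obtain hu | hu : u j = 0 ∨ u j = 1 := by generalize u j = b; revert b; decide
    all_goals
      have h2 : (1 : ZMod 2) + 1 = 0 := by decide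
      obtain rfl | hj0 := eq_or_ne j 0
      · simp [mapDecoder, bitStatistic, encAB, bpsk, hu, h2] at h ⊢
        linarith
      · simp [mapDecoder, bitStatistic, encAB, bpsk, hu, hj0, h2] at h ⊢
        linarith
  · refine Finset.prod_le_prod' fun b _ => le_of_eq ?_
    simp [encAB, hj]

lemma sum_indicator_mapDecoder_le (M : ℕ) (v : ℝ≥0) (i : Fin (M + 1))
    (y : Fin (M + 1) × Fin 2 → ℝ) (b : ZMod 2) :
    ∑ u : Fin (M + 1) → ZMod 2,
        (if mapDecoder M y i ≠ u i then codewordLikelihood M v u y else 0) ≤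
      ∑ u : Fin (M + 1) → ZMod 2, if b ≠ u i then codewordLikelihood M v u y else 0 := by
  by_cases hb : mapDecoder M y i = b
  · rw [hb]
  rw [← Equiv.sum_comp (Equiv.addRight (Pi.single i 1 : Fin (M + 1) → ZMod 2))
    fun u => if b ≠ u i then codewordLikelihood M v u y else 0]
  refine Finset.sum_le_sum fun u _ => ?_
  have hiff : mapDecoder M y i ≠ u i → b ≠ u i + 1 := by
    generalize mapDecoder M y i = d at hb
    generalize u i = e
    revert b d e
    decide
  by_cases h : mapDecoder M y i ≠ u i
  · have h' := hiff h
    rw [if_pos h, if_pos (by simpa using h')]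
    exact codewordLikelihood_le_flip M v i u y h
  · rw [if_neg h]
    exact zero_le

lemma sum_measure_ne_eq_lintegral (M : ℕ) {v : ℝ≥0} (hv : v ≠ 0) (i : Fin (M + 1))
    {ψ : (Fin (M + 1) × Fin 2 → ℝ) → Fin (M + 1) → ZMod 2} (hψ : Measurable ψ) :
    ∑ u : Fin (M + 1) → ZMod 2,
        (Measure.pi fun _ : Fin (M + 1) × Fin 2 => gaussianReal 0 v)
          {z | ψ (fun c => bpsk (encAB M u c) + z c) i ≠ u i} =
      ∫⁻ y, ∑ u : Fin (M + 1) → ZMod 2, (if ψ y i ≠ u i then codewordLikelihood M v u y else 0)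
        ∂(Measure.pi fun _ : Fin (M + 1) × Fin 2 => gaussianReal 0 v) := by
  have hS : ∀ u : Fin (M + 1) → ZMod 2, MeasurableSet {y | ψ y i ≠ u i} := fun u =>
    (measurable_pi_apply i).comp hψ (MeasurableSet.of_discrete (s := {b | b ≠ u i}))
  rw [lintegral_finsetSum _ fun u _ =>
    Measurable.ite (hS u) (measurable_codewordLikelihood M v u) measurable_const]
  refine Finset.sum_congr rfl fun u _ => ?_
  have hmap := Measure.map_apply (μ := Measure.pi fun _ : Fin (M + 1) × Fin 2 => gaussianReal 0 v)
    (f := fun z c => bpsk (encAB M u c) + z c) (by fun_prop) (hS u)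
  rw [pi_gaussianReal_map_const_add hv, withDensity_apply _ (hS u),
    ← lintegral_indicator (hS u)] at hmap
  refine hmap.symm.trans (lintegral_congr fun y => ?_)
  simp only [Set.indicator_apply, Set.mem_ofPred_eq]
  rfl

lemma uniform_prod_apply {α β : Type*} [Fintype α] [Nonempty α] [MeasurableSpace α]
    [MeasurableSingletonClass α] [MeasurableSpace β] (μ : Measure β) [SFinite μ] {S : Set (α × β)}
    (hS : MeasurableSet S) :
    (PMF.uniformOfFintype α).toMeasure.prod μ S =
      (Fintype.card α : ℝ≥0∞)⁻¹ * ∑ a, μ {b | (a, b) ∈ S} := by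
  rw [Measure.prod_apply hS, lintegral_fintype, Finset.mul_sum]
  refine Finset.sum_congr rfl fun a _ => ?_
  rw [PMF.toMeasure_apply_singleton _ _ (measurableSet_singleton a),
    PMF.uniformOfFintype_apply, mul_comm]
  rfl

/-- For the code `C = A × B^M ⊆ F₂^{2(M+1)}` with `A = {00, 10}` and `B = {00, 11}`,
under BPSK transmission over an AWGN channel with noise variance `σ²`, the minimal
achievable bit-error probability over all decoders equals
`(1/(M+1)) Q(1/σ) + (M/(M+1)) Q(√2/σ)`. -/
theorem ber_map_product_code_AB
    (M : ℕ) (hM : 1 ≤ M) (σ : ℝ) (hσ : 0 < σ)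
    -- the underlying probability measure: `U` uniform on `F₂^{M+1}`, independent
    -- i.i.d. Gaussian noise
    (P : Measure ((Fin (M + 1) → ZMod 2) × ((Fin (M + 1) × Fin 2) → ℝ)))
    (hP : P = ((PMF.uniformOfFintype (Fin (M + 1) → ZMod 2)).toMeasure).prod
        (Measure.pi fun _ : Fin (M + 1) × Fin 2 => gaussianReal 0 ((σ ^ 2).toNNReal)))
    -- the received vector
    (Y : (Fin (M + 1) → ZMod 2) × ((Fin (M + 1) × Fin 2) → ℝ) → (Fin (M + 1) × Fin 2) → ℝ)
    (hY : Y = fun ω c => bpsk (encAB M ω.1 c) + ω.2 c)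
    -- bit-error probability of a decoder
    (BER : (((Fin (M + 1) × Fin 2) → ℝ) → Fin (M + 1) → ZMod 2) → ℝ)
    (hBER : ∀ ψ, BER ψ = (1 / ((M : ℝ) + 1)) *
        ∑ i : Fin (M + 1), (P {ω | ψ (Y ω) i ≠ ω.1 i}).toReal) :
    (⨅ ψ : {f : ((Fin (M + 1) × Fin 2) → ℝ) → Fin (M + 1) → ZMod 2 // Measurable f},
        BER ψ.1) =
      (1 / ((M : ℝ) + 1)) * Qfun (1 / σ) +
        ((M : ℝ) / ((M : ℝ) + 1)) * Qfun (Real.sqrt 2 / σ) := by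
  subst hP hY
  set v : ℝ≥0 := (σ ^ 2).toNNReal with hvdef
  have hv : v ≠ 0 := by
    rw [hvdef, Ne, Real.toNNReal_eq_zero, not_le]
    positivity
  have hvσ : (v : ℝ) = σ ^ 2 := Real.coe_toNNReal _ (sq_nonneg σ)
  have hbit : ∀ ψ : ((Fin (M + 1) × Fin 2) → ℝ) → Fin (M + 1) → ZMod 2, Measurable ψ → ∀ i,
      (((PMF.uniformOfFintype (Fin (M + 1) → ZMod 2)).toMeasure).prod
        (Measure.pi fun _ : Fin (M + 1) × Fin 2 => gaussianReal 0 v))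
        {ω | ψ (fun c => bpsk (encAB M ω.1 c) + ω.2 c) i ≠ ω.1 i} =
      (Fintype.card (Fin (M + 1) → ZMod 2) : ℝ≥0∞)⁻¹ * ∑ u : Fin (M + 1) → ZMod 2,
        (Measure.pi fun _ : Fin (M + 1) × Fin 2 => gaussianReal 0 v)
          {z | ψ (fun c => bpsk (encAB M u c) + z c) i ≠ u i} := by
    intro ψ hψ i
    refine uniform_prod_apply _ (MeasurableSet.compl ?_)
    refine measurableSet_eq_fun ((measurable_pi_apply i).comp (hψ.comp ?_)) (by fun_prop)
    refine measurable_pi_lambda _ fun c => Measurable.add ?_ (by fun_prop)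
    exact (Measurable.of_discrete (f := fun u => bpsk (encAB M u c))).comp measurable_fst
  have hmapErr : ∀ i, (((PMF.uniformOfFintype (Fin (M + 1) → ZMod 2)).toMeasure).prod
        (Measure.pi fun _ : Fin (M + 1) × Fin 2 => gaussianReal 0 v))
        {ω | mapDecoder M (fun c => bpsk (encAB M ω.1 c) + ω.2 c) i ≠ ω.1 i} =
      ENNReal.ofReal (Qfun (bitWeight M i / √(bitWeight M i * v : ℝ≥0))) := by
    intro i
    rw [hbit _ (measurable_mapDecoder M)]
    simp_rw [measure_mapDecoder_ne M hv]
    rw [Finset.sum_const, Finset.card_univ, nsmul_eq_mul, ← mul_assoc,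
      ENNReal.inv_mul_cancel (by exact_mod_cast Fintype.card_ne_zero) (ENNReal.natCast_ne_top _),
      one_mul]
  have hopt : ∀ ψ : {f : ((Fin (M + 1) × Fin 2) → ℝ) → Fin (M + 1) → ZMod 2 // Measurable f},
      BER (mapDecoder M) ≤ BER ψ.1 := by
    rintro ⟨ψ, hψ⟩
    rw [hBER, hBER]
    refine mul_le_mul_of_nonneg_left (Finset.sum_le_sum fun i _ => ?_) (by positivity)
    refine ENNReal.toReal_mono (measure_ne_top _ _) ?_
    rw [hbit _ (measurable_mapDecoder M), hbit _ hψ, sum_measure_ne_eq_lintegral M hv i hψ,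
      sum_measure_ne_eq_lintegral M hv i (measurable_mapDecoder M)]
    refine mul_le_mul_right (lintegral_mono fun y => ?_) _
    exact sum_indicator_mapDecoder_le M v i y (ψ y i)
  have hzero : ((bitWeight M 0 : ℝ) / √(bitWeight M 0 * v : ℝ≥0)) = 1 / σ := by
    simp [bitWeight, hvσ, Real.sqrt_sq hσ.le]
  have hsucc : ∀ i : Fin M,
      ((bitWeight M i.succ : ℝ) / √(bitWeight M i.succ * v : ℝ≥0)) = √2 / σ := by
    intro i
    have h2 : √2 * √2 = (2 : ℝ) := Real.mul_self_sqrt (by norm_num)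
    simp only [bitWeight, Fin.succ_ne_zero, if_false, NNReal.coe_mul, NNReal.coe_ofNat, hvσ]
    rw [Real.sqrt_mul (by norm_num), Real.sqrt_sq hσ.le]
    field_simp
    linarith
  have hval : BER (mapDecoder M) = (1 / ((M : ℝ) + 1)) * Qfun (1 / σ) +
      ((M : ℝ) / ((M : ℝ) + 1)) * Qfun (Real.sqrt 2 / σ) := by
    rw [hBER]
    simp_rw [hmapErr, ENNReal.toReal_ofReal (Qfun_nonneg _)]
    rw [Fin.sum_univ_succ, hzero]
    simp_rw [hsucc]
    rw [Finset.sum_const, Finset.card_univ, Fintype.card_fin, nsmul_eq_mul]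
    ring
  rw [← hval]
  have : Nonempty {f : ((Fin (M + 1) × Fin 2) → ℝ) → Fin (M + 1) → ZMod 2 // Measurable f} :=
    ⟨⟨mapDecoder M, measurable_mapDecoder M⟩⟩
  exact le_antisymm
    (ciInf_le ⟨BER (mapDecoder M), Set.forall_mem_range.mpr hopt⟩
      ⟨mapDecoder M, measurable_mapDecoder M⟩)
    (le_ciInf hopt)
end
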